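/- A simplicial set X in which every Segal map φ_k : X_k → X_1 ×_{X_0} ⋯ ×_{X_0} X_1 (k ≥ 2) is a bijection is isomorphic to the nerve of a category; more precisely, the unit map X → N(τ₁ X) is an isomorphism. -/

import Mathlib

open CategoryTheory Simplicial

namespace SSet

open Opposite SimplexCategory

/-- The spine map is always bijective in dimensions `0` and `1`. -/
lemma isStrictSegal_of_spine_bijective {X : SSet.{u}}
    (h : ∀ k : ℕ, 2 ≤ k → Function.Bijective (X.spine k)) : X.IsStrictSegal where
  segal k := by
    match k with
    | 0 =>
      have h₀ (x : X _⦋0⦌) : (X.spine 0 x).vertex 0 = x := by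
        have : SimplexCategory.const ⦋0⦌ ⦋0⦌ 0 = 𝟙 _ := Subsingleton.elim _ _
        simp [this]
      exact ⟨fun x y hxy ↦ by rw [← h₀ x, hxy, h₀], fun p ↦ ⟨p.vertex 0, Path.ext₀ (h₀ _)⟩⟩
    | 1 =>
      have h₁ (x : X _⦋1⦌) : (X.spine 1 x).arrow 0 = x := by
        have : mkOfSucc (0 : Fin 1) = 𝟙 _ := SimplexCategory.Hom.ext_one_left _ _
        simp [this]
      refine ⟨fun x y hxy ↦ by rw [← h₁ x, hxy, h₁], fun p ↦ ⟨p.arrow 0, Path.ext' fun i ↦ ?_⟩⟩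
      fin_cases i
      exact h₁ _
    | k + 2 => exact h _ (by lia)

section simplexEdges

variable {X : SSet.{u}} {n : ℕ} (s : X _⦋n⦌)

/-- The `i`-th vertex of a simplex. -/
def simplexVertex (i : Fin (n + 1)) : X _⦋0⦌ := (X.spine n s).vertex i

/-- The edge of a simplex between the vertices `i ≤ j`. -/
def simplexEdge (i j : Fin (n + 1)) (hij : i ≤ j) :
    X.Edge (simplexVertex s i) (simplexVertex s j) :=
  .mk (X.map (mkOfLe i j hij).op s)
    (by
      rw [SimplicialObject.δ_def, ← Functor.map_comp_apply, ← op_comp]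
      refine congr_arg (fun f ↦ X.map (Quiver.Hom.op f) s) ?_
      ext x; fin_cases x; rfl)
    (by
      rw [SimplicialObject.δ_def, ← Functor.map_comp_apply, ← op_comp]
      refine congr_arg (fun f ↦ X.map (Quiver.Hom.op f) s) ?_
      ext x; fin_cases x; rfl)

/-- The triangle of a simplex on the vertices `i ≤ j ≤ k`. -/
def simplexTriangle (i j k : Fin (n + 1)) (hij : i ≤ j) (hjk : j ≤ k) :
    Edge.CompStruct (simplexEdge s i j hij) (simplexEdge s j k hjk)
      (simplexEdge s i k (hij.trans hjk)) :=
  .mk (X.map (mkOfLeComp i j k hij hjk).op s)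
    (by
      rw [SimplicialObject.δ_def, ← Functor.map_comp_apply, ← op_comp]
      exact congr_arg (fun f ↦ X.map (Quiver.Hom.op f) s) (SimplexCategory.Hom.ext_one_left _ _))
    (by
      rw [SimplicialObject.δ_def, ← Functor.map_comp_apply, ← op_comp]
      exact congr_arg (fun f ↦ X.map (Quiver.Hom.op f) s) (SimplexCategory.Hom.ext_one_left _ _))
    (by
      rw [SimplicialObject.δ_def, ← Functor.map_comp_apply, ← op_comp]
      exact congr_arg (fun f ↦ X.map (Quiver.Hom.op f) s) (SimplexCategory.Hom.ext_one_left _ _))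

lemma simplexEdge_succ (i : Fin n) :
    (simplexEdge s i.castSucc i.succ i.castSucc_lt_succ.le).edge = (X.spine n s).arrow i :=
  congr_arg (fun f ↦ X.map (Quiver.Hom.op f) s) (SimplexCategory.Hom.ext_one_left _ _)

lemma simplexEdge_self (i : Fin (n + 1)) :
    simplexEdge s i i le_rfl = Edge.id (simplexVertex s i) := by
  ext
  refine .trans ?_ (Functor.map_comp_apply X _ _ s)
  exact congr_arg (fun f ↦ X.map (Quiver.Hom.op f) s) (SimplexCategory.Hom.ext_one_left _ _)

lemma simplexVertex_map {m : ℕ} (f : ⦋m⦌ ⟶ ⦋n⦌) (i : Fin (m + 1)) :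
    simplexVertex (X.map f.op s) i = simplexVertex s (f.toOrderHom i) :=
  spine_map_vertex _ _ _ _ _

lemma simplexEdge_map {m : ℕ} (f : ⦋m⦌ ⟶ ⦋n⦌) (i j : Fin (m + 1)) (hij : i ≤ j) :
    (simplexEdge (X.map f.op s) i j hij).edge =
      (simplexEdge s (f.toOrderHom i) (f.toOrderHom j) (f.toOrderHom.monotone hij)).edge := by
  refine (Functor.map_comp_apply X _ _ s).symm.trans ?_
  exact congr_arg (fun f ↦ X.map (Quiver.Hom.op f) s) (SimplexCategory.Hom.ext_one_left _ _)

end simplexEdges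

section IsStrictSegal

variable {X : SSet.{u}} [X.IsStrictSegal]

lemma IsStrictSegal.ext {n : ℕ} {s t : X _⦋n + 1⦌}
    (h : ∀ i, (X.spine _ s).arrow i = (X.spine _ t).arrow i) : s = t :=
  (IsStrictSegal.segal (n + 1)).injective (Path.ext' h)

/-- In a strict Segal simplicial set, the third edge of a triangle is determined
by the first two. -/
lemma Edge.CompStruct.edge_eq {x₀ x₁ x₂ y₀ y₁ y₂ : X _⦋0⦌}
    {e₀₁ : X.Edge x₀ x₁} {e₁₂ : X.Edge x₁ x₂} {e₀₂ : X.Edge x₀ x₂}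
    {f₀₁ : X.Edge y₀ y₁} {f₁₂ : X.Edge y₁ y₂} {f₀₂ : X.Edge y₀ y₂}
    (h : Edge.CompStruct e₀₁ e₁₂ e₀₂) (h' : Edge.CompStruct f₀₁ f₁₂ f₀₂)
    (h₀₁ : e₀₁.edge = f₀₁.edge) (h₁₂ : e₁₂.edge = f₁₂.edge) : e₀₂.edge = f₀₂.edge := by
  rw [← h.d₁, ← h'.d₁]
  congr 1
  refine IsStrictSegal.ext fun i ↦ ?_
  fin_cases i
  · have h₂ : X.δ 2 h.simplex = X.δ 2 h'.simplex := by rw [h.d₂, h'.d₂, h₀₁]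
    rwa [SimplicialObject.δ_def, ← mkOfSucc_zero_eq_δ] at h₂
  · have h₀ : X.δ 0 h.simplex = X.δ 0 h'.simplex := by rw [h.d₀, h'.d₀, h₁₂]
    rwa [SimplicialObject.δ_def, ← mkOfSucc_one_eq_δ] at h₀

variable {x₀ x₁ x₂ x₃ : X _⦋0⦌}

lemma Edge.exists_compStruct (e₀₁ : X.Edge x₀ x₁) (e₁₂ : X.Edge x₁ x₂) :
    ∃ e₀₂ : X.Edge x₀ x₂, Nonempty (Edge.CompStruct e₀₁ e₁₂ e₀₂) := by
  let p : X.Path 2 :=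
    { vertex := ![x₀, x₁, x₂]
      arrow := ![e₀₁.edge, e₁₂.edge]
      arrow_src i := by
        fin_cases i
        exacts [e₀₁.src_eq, e₁₂.src_eq]
      arrow_tgt i := by
        fin_cases i
        exacts [e₀₁.tgt_eq, e₁₂.tgt_eq] }
  obtain ⟨s, hs⟩ := (IsStrictSegal.segal 2).surjective p
  have hv (i) : simplexVertex s i = p.vertex i := Path.congr_vertex hs i
  exact ⟨(simplexEdge s 0 2 (by simp)).ofEq (hv 0) (hv 2),
    ⟨(simplexTriangle s 0 1 2 (by simp) (by simp)).ofEq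
      ((simplexEdge_succ s 0).trans (Path.congr_arrow hs 0))
      ((simplexEdge_succ s 1).trans (Path.congr_arrow hs 1)) rfl⟩⟩

/-- The composition of edges in a strict Segal simplicial set. -/
noncomputable def Edge.comp (e₀₁ : X.Edge x₀ x₁) (e₁₂ : X.Edge x₁ x₂) : X.Edge x₀ x₂ :=
  (e₀₁.exists_compStruct e₁₂).choose

/-- The triangle which exhibits `Edge.comp` as a composition. -/
noncomputable def Edge.compStruct (e₀₁ : X.Edge x₀ x₁) (e₁₂ : X.Edge x₁ x₂) :
    Edge.CompStruct e₀₁ e₁₂ (e₀₁.comp e₁₂) :=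
  (e₀₁.exists_compStruct e₁₂).choose_spec.some

lemma Edge.CompStruct.comp_eq {e₀₁ : X.Edge x₀ x₁} {e₁₂ : X.Edge x₁ x₂} {e₀₂ : X.Edge x₀ x₂}
    (h : Edge.CompStruct e₀₁ e₁₂ e₀₂) : e₀₁.comp e₁₂ = e₀₂ :=
  Edge.ext ((e₀₁.compStruct e₁₂).edge_eq h rfl rfl)

lemma Edge.comp_assoc (e₀₁ : X.Edge x₀ x₁) (e₁₂ : X.Edge x₁ x₂) (e₂₃ : X.Edge x₂ x₃) :
    (e₀₁.comp e₁₂).comp e₂₃ = e₀₁.comp (e₁₂.comp e₂₃) := by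
  let p : X.Path 3 :=
    { vertex := ![x₀, x₁, x₂, x₃]
      arrow := ![e₀₁.edge, e₁₂.edge, e₂₃.edge]
      arrow_src i := by
        fin_cases i
        exacts [e₀₁.src_eq, e₁₂.src_eq, e₂₃.src_eq]
      arrow_tgt i := by
        fin_cases i
        exacts [e₀₁.tgt_eq, e₁₂.tgt_eq, e₂₃.tgt_eq] }
  obtain ⟨s, hs⟩ := (IsStrictSegal.segal 3).surjective p
  have h₀₁ := (simplexEdge_succ s 0).trans (Path.congr_arrow hs 0)
  have h₁₂ := (simplexEdge_succ s 1).trans (Path.congr_arrow hs 1)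
  have h₂₃ := (simplexEdge_succ s 2).trans (Path.congr_arrow hs 2)
  have h₀₂ := (simplexTriangle s 0 1 2 (by decide) (by decide)).edge_eq
    (e₀₁.compStruct e₁₂) h₀₁ h₁₂
  have h₁₃ := (simplexTriangle s 1 2 3 (by decide) (by decide)).edge_eq
    (e₁₂.compStruct e₂₃) h₁₂ h₂₃
  ext
  exact ((simplexTriangle s 0 2 3 (by decide) (by decide)).edge_eq
      ((e₀₁.comp e₁₂).compStruct e₂₃) h₀₂ h₂₃).symm.trans
    ((simplexTriangle s 0 1 3 (by decide) (by decide)).edge_eq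
      (e₀₁.compStruct (e₁₂.comp e₂₃)) h₀₁ h₁₃)

end IsStrictSegal

/-- The type of vertices of a strict Segal simplicial set, considered as the type of
objects of the category whose morphisms are the edges. -/
def EdgeCategory (X : SSet.{u}) : Type u := X _⦋0⦌

namespace EdgeCategory

variable (X : SSet.{u}) [X.IsStrictSegal]

noncomputable instance : Category.{u} X.EdgeCategory where
  Hom x y := X.Edge (x₀ := x) (x₁ := y)
  id x := Edge.id (X := X) x
  comp f g := Edge.comp f g
  id_comp f := (Edge.CompStruct.idComp f).comp_eq
  comp_id f := (Edge.CompStruct.compId f).comp_eq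
  assoc f g h := Edge.comp_assoc f g h

variable {X}

/-- The edge underlying a morphism. -/
def homEdge {x y : X.EdgeCategory} (f : x ⟶ y) : X _⦋1⦌ := Edge.edge f

lemma hom_ext {x y : X.EdgeCategory} {f g : x ⟶ y} (h : homEdge f = homEdge g) : f = g :=
  Edge.ext h

lemma homEdge_eqToHom_conj {x y x' y' : X.EdgeCategory} (f : x ⟶ y) (hx : x' = x) (hy : y = y') :
    homEdge (eqToHom hx ≫ f ≫ eqToHom hy) = homEdge f := by
  subst hx hy
  simp

/-- The composable arrows in `X.EdgeCategory` given by the edges of a simplex of `X`. -/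
def simplexFunctor {n : ℕ} (s : X _⦋n⦌) : ComposableArrows X.EdgeCategory n where
  obj i := simplexVertex s i
  map f := simplexEdge s _ _ (leOfHom f)
  map_id i := simplexEdge_self s i
  map_comp f g := (simplexTriangle s _ _ _ (leOfHom f) (leOfHom g)).comp_eq.symm

lemma composableArrows_functor_ext {n : ℕ} {F G : ComposableArrows X.EdgeCategory n}
    (hobj : ∀ i, F.obj i = G.obj i)
    (hmap : ∀ i j (f : i ⟶ j), homEdge (F.map f) = homEdge (G.map f)) : F = G :=
  CategoryTheory.Functor.ext hobj fun i j f ↦ hom_ext (by rw [homEdge_eqToHom_conj, hmap])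

variable (X) in
/-- The morphism from a strict Segal simplicial set to the nerve of its category of edges. -/
def toNerve : X ⟶ nerve X.EdgeCategory where
  app n := ↾fun s ↦ simplexFunctor (n := n.unop.len) s
  naturality n m f := by
    ext s
    exact composableArrows_functor_ext
      (fun i ↦ simplexVertex_map (n := n.unop.len) (m := m.unop.len) s f.unop i)
      (fun i j g ↦ simplexEdge_map (n := n.unop.len) (m := m.unop.len) s f.unop i j (leOfHom g))

lemma simplexFunctor_bijective (n : ℕ) :
    Function.Bijective (simplexFunctor (X := X) (n := n)) := by
  refine ⟨fun s t hst ↦ (IsStrictSegal.segal n).injective (Path.ext ?_ ?_), fun F ↦ ?_⟩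
  · exact congr_arg Functor.obj hst
  · ext i
    rw [← simplexEdge_succ, ← simplexEdge_succ]
    exact congr_arg
      (fun F : ComposableArrows X.EdgeCategory n ↦
        homEdge (F.map (homOfLE i.castSucc_lt_succ.le))) hst
  · let p : X.Path n :=
      { vertex := F.obj
        arrow i := homEdge (F.map (homOfLE i.castSucc_lt_succ.le))
        arrow_src i := Edge.src_eq (F.map (homOfLE i.castSucc_lt_succ.le))
        arrow_tgt i := Edge.tgt_eq (F.map (homOfLE i.castSucc_lt_succ.le)) }
    obtain ⟨s, hs⟩ := (IsStrictSegal.segal n).surjective p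
    refine ⟨s, ComposableArrows.ext (Path.congr_vertex hs) fun i hi ↦ hom_ext ?_⟩
    exact ((simplexEdge_succ s ⟨i, hi⟩).trans (Path.congr_arrow hs ⟨i, hi⟩)).trans
      (homEdge_eqToHom_conj _ _ _).symm

instance : IsIso (toNerve X) := by
  have (n : SimplexCategoryᵒᵖ) : IsIso ((toNerve X).app n) :=
    (isIso_iff_bijective _).2 (simplexFunctor_bijective n.unop.len)
  exact NatIso.isIso_of_isIso_app _

end EdgeCategory

end SSet

/-- A simplicial set all of whose Segal maps
`φ_k : X_k → X_1 ×_{X_0} ⋯ ×_{X_0} X_1` (for `k ≥ 2`) are bijections (here the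
fiber product is encoded as the type of paths of `k` composable edges, and the
Segal map as the spine map) is isomorphic to the nerve of a category: the unit
map `X ⟶ N(τ₁ X)` of any adjunction `τ₁ ⊣ N` is an isomorphism. -/
theorem unit_isIso_of_segal_maps_bijective (X : SSet.{u})
    (h : ∀ k : ℕ, 2 ≤ k → Function.Bijective (X.spine k))
    (τ : SSet.{u} ⥤ Cat.{u, u}) (adj : τ ⊣ nerveFunctor.{u, u}) :
    IsIso (adj.unit.app X) := by
  have := SSet.isStrictSegal_of_spine_bijective h
  exact adj.isIso_unit_app_of_iso (X := Cat.of X.EdgeCategory)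
    (asIso (SSet.EdgeCategory.toNerve X) : X ≅ nerve X.EdgeCategory)
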